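/- Let A ∈ ℝ^{n×n}, let P ∈ ℝ^{n×n} be a permutation matrix, and let B ∈ ℝ^{m×m} be any matrix. Assume ‖x_A⁽ᵗ⁾‖₁ ≠ 0 for all 0 ≤ t < k and that Σ^A and Σ^B are positive definite. Then the power kernel is invariant to reordering the vertices of A: ∫_{ℝᵏ} √(Ψ^{PAPᵀ}(x)) √(Ψ^B(x)) dx = ∫_{ℝᵏ} √(Ψ^A(x)) √(Ψ^B(x)) dx, i.e., K(PAPᵀ, B) = K(A, B). -/

import Mathlib

open Matrix MeasureTheory Real BigOperators

/-- The permutation matrix of `σ`: `(P v) (σ i) = v i`. -/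
noncomputable def permMatrix {n : ℕ} (σ : Equiv.Perm (Fin n)) : Matrix (Fin n) (Fin n) ℝ :=
  Matrix.of fun i j => if i = σ j then 1 else 0

/-- ℓ1 norm of a vector. -/
noncomputable def l1norm {n : ℕ} (v : Fin n → ℝ) : ℝ := ∑ i, |v i|

/-- Power iteration started at the all-ones vector. -/
noncomputable def powerIter {n : ℕ} (A : Matrix (Fin n) (Fin n) ℝ) : ℕ → (Fin n → ℝ)
  | 0 => fun _ => 1
  | t + 1 => A.mulVec ((l1norm (powerIter A t))⁻¹ • powerIter A t)

/-- Power summary `S^A ∈ ℝ^{n×k}`, whose `t`-th column is `x_A^{(t+1)}`. -/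
noncomputable def powSummary {n : ℕ} (k : ℕ) (A : Matrix (Fin n) (Fin n) ℝ) :
    Matrix (Fin n) (Fin k) ℝ :=
  Matrix.of fun i t => powerIter A (t + 1) i

/-- Mean vector of the rows of the power summary. -/
noncomputable def meanVec {n : ℕ} (k : ℕ) (A : Matrix (Fin n) (Fin n) ℝ) : Fin k → ℝ :=
  (n : ℝ)⁻¹ • ∑ i, powSummary k A i

/-- Sample covariance matrix of the rows of the power summary. -/
noncomputable def covMat {n : ℕ} (k : ℕ) (A : Matrix (Fin n) (Fin n) ℝ) :
    Matrix (Fin k) (Fin k) ℝ :=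
  (n : ℝ)⁻¹ • ∑ i, vecMulVec (powSummary k A i - meanVec k A) (powSummary k A i - meanVec k A)

/-- Gaussian functional representation `Ψ^A`. -/
noncomputable def psi {n : ℕ} (k : ℕ) (A : Matrix (Fin n) (Fin n) ℝ) (x : Fin k → ℝ) : ℝ :=
  (Real.sqrt ((2 * Real.pi) ^ k * (covMat k A).det))⁻¹ *
    Real.exp (-(dotProduct (x - meanVec k A) ((covMat k A)⁻¹ *ᵥ (x - meanVec k A))) / 2)


lemma permMatrix_mul_mul_transpose {n : ℕ} (A : Matrix (Fin n) (Fin n) ℝ)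
    (σ : Equiv.Perm (Fin n)) :
    permMatrix σ * A * (permMatrix σ)ᵀ = A.submatrix σ.symm σ.symm := by
  ext i j
  simp [permMatrix, Matrix.mul_apply, ← Equiv.symm_apply_eq]

lemma l1norm_comp_equiv {n : ℕ} (v : Fin n → ℝ) (e : Equiv.Perm (Fin n)) :
    l1norm (v ∘ e) = l1norm v :=
  Equiv.sum_comp e fun i => |v i|

lemma powerIter_submatrix {n : ℕ} (A : Matrix (Fin n) (Fin n) ℝ) (e : Equiv.Perm (Fin n))
    (t : ℕ) : powerIter (A.submatrix e e) t = powerIter A t ∘ e := by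
  induction t with
  | zero => rfl
  | succ t ih =>
    rw [powerIter, ih, l1norm_comp_equiv, powerIter, Matrix.submatrix_mulVec_equiv]
    congr 2
    ext i
    simp

lemma powSummary_submatrix {n : ℕ} (k : ℕ) (A : Matrix (Fin n) (Fin n) ℝ)
    (e : Equiv.Perm (Fin n)) (i : Fin n) :
    powSummary k (A.submatrix e e) i = powSummary k A (e i) := by
  ext t
  simp [powSummary, powerIter_submatrix]

lemma meanVec_submatrix {n : ℕ} (k : ℕ) (A : Matrix (Fin n) (Fin n) ℝ)
    (e : Equiv.Perm (Fin n)) : meanVec k (A.submatrix e e) = meanVec k A := by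
  simp only [meanVec, powSummary_submatrix]
  rw [Equiv.sum_comp e fun i => powSummary k A i]

lemma covMat_submatrix {n : ℕ} (k : ℕ) (A : Matrix (Fin n) (Fin n) ℝ)
    (e : Equiv.Perm (Fin n)) : covMat k (A.submatrix e e) = covMat k A := by
  simp only [covMat, powSummary_submatrix, meanVec_submatrix]
  rw [Equiv.sum_comp e fun i =>
    vecMulVec (powSummary k A i - meanVec k A) (powSummary k A i - meanVec k A)]

lemma psi_submatrix {n : ℕ} (k : ℕ) (A : Matrix (Fin n) (Fin n) ℝ)
    (e : Equiv.Perm (Fin n)) : psi k (A.submatrix e e) = psi k A := by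
  ext x
  simp only [psi, meanVec_submatrix, covMat_submatrix]

/-- The power kernel is invariant under reordering the vertices of one of the graphs:
`K(PAPᵀ, B) = K(A, B)`. -/
theorem power_kernel_perm_invariant {n m k : ℕ} (A : Matrix (Fin n) (Fin n) ℝ)
    (σ : Equiv.Perm (Fin n)) (B : Matrix (Fin m) (Fin m) ℝ)
    (hl1 : ∀ t < k, l1norm (powerIter A t) ≠ 0)
    (hA : (covMat k A).PosDef) (hB : (covMat k B).PosDef) :
    (∫ x : Fin k → ℝ, Real.sqrt (psi k (permMatrix σ * A * (permMatrix σ)ᵀ) x) *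
        Real.sqrt (psi k B x)) =
      ∫ x : Fin k → ℝ, Real.sqrt (psi k A x) * Real.sqrt (psi k B x) := by
  rw [permMatrix_mul_mul_transpose, psi_submatrix]
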